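/- arXiv:0809.0689 — 5 statements merged into one kernel-verified Lean document; each statement's English description precedes it below -/
import Mathlib

section
/- Every extended pure Nash equilibrium (s, y) of the extended game satisfies y_i = u_i(s) for every player i; that is, it has the form (s; u_1(s),…,u_n(s)). -/
open Finset

theorem stmt5
    {n : ℕ} {d : Fin n → ℕ}
    (Si : ∀ i, Set (Fin (d i) → ℤ))
    (hSfin : ∀ i, (Si i).Finite) (hSne : ∀ i, (Si i).Nonempty)
    {K L : Fin n → Type*}
    [∀ i, Fintype (K i)] [∀ i, Nonempty (K i)] [∀ i, LinearOrder (K i)]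
    [∀ i, Fintype (L i)] [∀ i, Nonempty (L i)]
    (f : ∀ i, K i → (∀ j, Fin (d j) → ℤ) → ℤ)
    (g : ∀ i, L i → (∀ j, Fin (d j) → ℤ) → ℤ)
    (hf : ∀ i k, ∃ (α : ∀ j, Fin (d j) → ℤ) (β : ℤ),
        ∀ s, f i k s = (∑ j, ∑ t, α j t * s j t) + β)
    (hg : ∀ i l, ∃ (γ : ∀ j, Fin (d j) → ℤ) (δ : ℤ),
        ∀ s, g i l s = (∑ j, ∑ t, γ j t * s j t) + δ)
    (S : Set (∀ j, Fin (d j) → ℤ)) (hS : S = Set.pi Set.univ Si)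
    (u : ∀ i, (∀ j, Fin (d j) → ℤ) → ℤ)
    (hu : ∀ i s, u i s = (univ.sup' univ_nonempty fun k => f i k s)
        - (univ.sup' univ_nonempty fun l => g i l s))
    (Sik : ∀ i, K i → Set (∀ j, Fin (d j) → ℤ))
    (hSik : ∀ i k, Sik i k = {s ∈ S |
        (∀ j, k < j → f i j s ≤ f i k s) ∧ (∀ j, j < k → f i j s < f i k s)})
    (Sk : (∀ i, K i) → Set (∀ j, Fin (d j) → ℤ))
    (hSk : ∀ k, Sk k = ⋂ i, Sik i (k i))
    (hpos : ∀ i, ∀ s ∈ S, 0 ≤ u i s)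
    (Shatk : (∀ i, K i) → Set ((∀ j, Fin (d j) → ℤ) × (Fin n → ℤ)))
    (hShatk : ∀ k, Shatk k = {p | p.1 ∈ Sk k ∧
        ∀ i, 0 ≤ p.2 i ∧ ∀ l : L i, p.2 i ≤ f i (k i) p.1 - g i l p.1})
    (Shat : Set ((∀ j, Fin (d j) → ℤ) × (Fin n → ℤ)))
    (hShat : Shat = ⋃ k, Shatk k)
    (Nhat : Set ((∀ j, Fin (d j) → ℤ) × (Fin n → ℤ)))
    (hNhat : ∀ p, p ∈ Nhat ↔ ∃ k, p ∈ Shatk k ∧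
        ∀ (i : Fin n) (k' : K i) (si' : Fin (d i) → ℤ) (yi' : ℤ),
          (Function.update p.1 i si', Function.update p.2 i yi') ∈
            Shatk (Function.update k i k') → yi' ≤ p.2 i)
    :
    ∀ p ∈ Nhat, ∀ i, p.2 i = u i p.1 := by
  intro p hp i
  obtain ⟨k, hpk, hopt⟩ := (hNhat p).1 hp
  obtain ⟨hsk, hy⟩ : p.1 ∈ Sk k ∧
      ∀ i, 0 ≤ p.2 i ∧ ∀ l : L i, p.2 i ≤ f i (k i) p.1 - g i l p.1 := by
    simpa [hShatk] using hpk
  have hsi : p.1 ∈ Sik i (k i) := by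
    rw [hSk] at hsk
    exact Set.mem_iInter.1 hsk i
  rw [hSik] at hsi
  obtain ⟨hsS, hge, hgt⟩ := hsi
  have hmax : (univ.sup' univ_nonempty fun k => f i k p.1) = f i (k i) p.1 := by
    refine le_antisymm (sup'_le _ _ fun j _ => ?_)
      (le_sup' (fun k => f i k p.1) (mem_univ (k i)))
    rcases lt_trichotomy (k i) j with h | h | h
    · exact hge j h
    · rw [h]
    · exact (hgt j h).le
  have hui := hu i p.1
  rw [hmax] at hui
  apply le_antisymm
  · obtain ⟨l, -, hl⟩ := exists_mem_eq_sup' univ_nonempty fun l => g i l p.1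
    rw [hui, hl]
    exact (hy i).2 l
  · apply hopt i (k i) (p.1 i) (u i p.1)
    rw [Function.update_eq_self, Function.update_eq_self, hShatk]
    refine ⟨hsk, fun j => ?_⟩
    by_cases hj : j = i
    · subst hj
      simp only [Function.update_self]
      refine ⟨hpos j _ hsS, fun l => ?_⟩
      rw [hui]
      exact sub_le_sub_left (le_sup' (fun l => g j l p.1) (mem_univ l)) _
    · simpa only [Function.update_of_ne hj] using hy j
end

section
/- Let A_1, …, A_n be nonempty finite sets, let A = A_1 × ⋯ × A_n, and let π : A → ℤ. For a_i ∈ A_i, let χ_i(a_i) ∈ {0,1}^{A_i} denote its characteristic vector, and for a ∈ A write χ(a) = (χ_1(a_1),…,χ_n(a_n)) ∈ ℤ^d with d = |A_1| + ⋯ + |A_n|. Then there exist nonempty finite index sets K and L and affine functions f_k, g_l : ℤ^d → ℤ (k ∈ K, l ∈ L) with integer coefficients such that π(a) = max_{k∈K} f_k(χ(a)) − max_{l∈L} g_l(χ(a)) for every a ∈ A. -/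
open Finset

/-- Every integer function on a finite product is the upper envelope of the functions
`a ↦ π c - M * #{i | c i ≠ a i}`, once `M` is large enough. -/
lemma exists_penalty_isGreatest {ι : Type*} [Fintype ι] {A : ι → Type*}
    [∀ i, DecidableEq (A i)] [Finite (∀ i, A i)] (π : (∀ i, A i) → ℤ) :
    ∃ M : ℤ, ∀ a, IsGreatest (Set.range fun c => (∑ i, if c i = a i then 0 else -M) + π c)
      (π a) := by
  classical
  obtain ⟨u, hu⟩ := (Set.finite_range π).bddAbove
  obtain ⟨l, hl⟩ := (Set.finite_range π).bddBelow
  refine ⟨u - l, fun a => ⟨⟨a, by simp⟩, ?_⟩⟩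
  rintro _ ⟨c, rfl⟩
  have hlu : ∀ x y, π x - π y ≤ u - l := fun x y =>
    sub_le_sub (hu ⟨x, rfl⟩) (hl ⟨y, rfl⟩)
  have hM : 0 ≤ u - l := by simpa using hlu a a
  by_cases h : c = a
  · simp [h]
  · obtain ⟨j, hj⟩ := Function.ne_iff.mp h
    have hsum : (∑ i, if c i = a i then 0 else -(u - l)) ≤ -(u - l) := by
      rw [← Finset.add_sum_erase _ _ (mem_univ j), if_neg hj]
      refine add_le_of_nonpos_right (sum_nonpos fun i _ => ?_)
      split_ifs <;> linarith
    have := hlu c a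
    dsimp only
    linarith

theorem stmt9 {n : ℕ} (A : Fin n → Type*) [∀ i, Fintype (A i)] [∀ i, Nonempty (A i)]
    [∀ i, DecidableEq (A i)]
    (π : (∀ i, A i) → ℤ)
    (χ : (∀ i, A i) → ∀ i, A i → ℤ)
    (hχ : ∀ a i b, χ a i b = if a i = b then 1 else 0) :
    ∃ (κ lam : ℕ) (hκ : 0 < κ) (hlam : 0 < lam)
      (α : Fin κ → ∀ i, A i → ℤ) (β : Fin κ → ℤ)
      (γ : Fin lam → ∀ i, A i → ℤ) (δ : Fin lam → ℤ),
      ∀ a, π a =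
        (univ.sup' ⟨⟨0, hκ⟩, mem_univ _⟩
          fun k => (∑ i, ∑ b, α k i b * χ a i b) + β k)
        - (univ.sup' ⟨⟨0, hlam⟩, mem_univ _⟩
          fun l => (∑ i, ∑ b, γ l i b * χ a i b) + δ l) := by
  obtain ⟨M, hM⟩ := exists_penalty_isGreatest π
  let e := Fintype.equivFin (∀ i, A i)
  refine ⟨Fintype.card (∀ i, A i), 1, Fintype.card_pos, one_pos,
    fun k i b => if e.symm k i = b then 0 else -M, fun k => π (e.symm k), 0, 0, fun a => ?_⟩
  simp only [hχ, mul_ite, mul_one, mul_zero, sum_ite_eq, mem_univ, if_true, Pi.zero_apply,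
    ite_self, sum_const_zero, add_zero]
  refine (sub_zero _).symm.trans (congrArg₂ (· - ·) ?_ (sup'_const _ (0 : ℤ)).symm)
  obtain ⟨-, hmax⟩ := hM a
  refine le_antisymm ?_ (sup'_le _ _ fun k _ => hmax ⟨e.symm k, rfl⟩)
  exact (le_sup'_iff _).mpr ⟨e a, mem_univ _, by
    simp only [Equiv.symm_apply_apply, if_true, sum_const_zero, zero_add, le_refl]⟩
end

section
/- Let A_1, …, A_n be nonempty finite sets, A = A_1 × ⋯ × A_n, and π : A → ℤ. Let A⁺ = {a ∈ A : π(a) > 0} and A⁻ = {a ∈ A : π(a) < 0}, and for a, a' ∈ A let m(a, a') = |{i ∈ {1,…,n} : a_i = a'_i}| be the number of coordinates in which a and a' agree. Then for every a ∈ A: π(a) = max({0} ∪ {π(a')·(m(a,a') − n + 1) : a' ∈ A⁺}) − max({0} ∪ {π(a')·(n − m(a,a') − 1) : a' ∈ A⁻}). -/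
open Finset

theorem card_filter_eq_lt_of_ne {n : ℕ} {A : Fin n → Type*} [∀ i, DecidableEq (A i)]
    {a a' : ∀ i, A i} (h : a ≠ a') : (univ.filter fun i => a i = a' i).card < n := by
  obtain ⟨i, hi⟩ := Function.ne_iff.mp h
  have hlt := card_lt_univ_of_notMem (s := univ.filter fun i => a i = a' i) (x := i) (by simp [hi])
  simpa using hlt

/-- If `c` equals `1` at `a` and is nonpositive elsewhere, then the largest value of `f * c`
over the points where `f` is positive, truncated below at `0`, is the positive part of `f a`. -/
theorem max'_insert_zero_image_mul {α : Type*} (s : Finset α) (f g c : α → ℤ) (a : α)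
    (hs : ∀ x, x ∈ s ↔ 0 < f x) (hg : ∀ x, g x = f x * c x) (hca : c a = 1)
    (hc : ∀ x, a ≠ x → c x ≤ 0) :
    (insert 0 (s.image g)).max' (insert_nonempty _ _) = max 0 (f a) := by
  have hga : g a = f a := by rw [hg, hca, mul_one]
  apply le_antisymm
  · refine max'_le _ _ _ fun y hy => ?_
    rcases mem_insert.mp hy with rfl | hy
    · exact le_max_left _ _
    · obtain ⟨x, hx, rfl⟩ := mem_image.mp hy
      by_cases h : a = x
      · subst h
        exact hga.le.trans (le_max_right _ _)
      · refine le_trans ?_ (le_max_left _ _)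
        rw [hg]
        exact mul_nonpos_of_nonneg_of_nonpos ((hs x).mp hx).le (hc x h)
  · refine max_le (le_max' _ _ (mem_insert_self _ _)) ?_
    by_cases h : 0 < f a
    · exact le_max' _ _ (mem_insert_of_mem (mem_image.mpr ⟨a, (hs a).mpr h, hga⟩))
    · exact (not_lt.mp h).trans (le_max' _ _ (mem_insert_self _ _))

theorem stmt10 {n : ℕ} (A : Fin n → Type*) [∀ i, Fintype (A i)] [∀ i, Nonempty (A i)]
    [∀ i, DecidableEq (A i)]
    (π : (∀ i, A i) → ℤ)
    (mm : (∀ i, A i) → (∀ i, A i) → ℕ)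
    (hmm : ∀ a a', mm a a' = (univ.filter fun i => a i = a' i).card) :
    ∀ a, π a =
      (insert 0 ((univ.filter fun a' => 0 < π a').image
          fun a' => π a' * ((mm a a' : ℤ) - (n : ℤ) + 1))).max' (insert_nonempty _ _)
      - (insert 0 ((univ.filter fun a' => π a' < 0).image
          fun a' => π a' * ((n : ℤ) - (mm a a' : ℤ) - 1))).max' (insert_nonempty _ _) := by
  intro a
  have hself : (mm a a : ℤ) - n + 1 = 1 := by simp [hmm]
  have hne : ∀ a', a ≠ a' → (mm a a' : ℤ) - n + 1 ≤ 0 := fun a' h => by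
    have := card_filter_eq_lt_of_ne h
    rw [← hmm] at this
    lia
  rw [max'_insert_zero_image_mul _ π _ (fun a' => (mm a a' : ℤ) - n + 1) a (by simp)
      (fun _ => rfl) hself hne,
    max'_insert_zero_image_mul _ (fun a' => -π a') _ (fun a' => (mm a a' : ℤ) - n + 1) a
      (by simp) (fun _ => by ring) hself hne]
  lia
end

section
/- Every Pareto optimal extended profile has the form (s; u_1(s),…,u_n(s)), and the map s ↦ (s; u_1(s),…,u_n(s)) is a bijection from the set PO of Pareto optimal action profiles of the game G onto the set PÔ of Pareto optimal extended profiles of the extended game. -/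
open Finset

theorem exists_first_maximizer {ι α : Type*} [Fintype ι] [Nonempty ι] [LinearOrder ι]
    [LinearOrder α] (φ : ι → α) :
    ∃ k, (∀ j, k < j → φ j ≤ φ k) ∧ ∀ j, j < k → φ j < φ k := by
  obtain ⟨m, hm⟩ := Finite.exists_max φ
  obtain ⟨k, hk, hmin⟩ := (Set.toFinite {k | ∀ j, φ j ≤ φ k}).exists_minimal ⟨m, hm⟩
  refine ⟨k, fun j _ => hk j, fun j hj => (hk j).lt_of_ne fun h => ?_⟩
  exact hj.not_ge (hmin (fun i => (hk i).trans_eq h.symm) hj.le)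

theorem sup'_univ_eq_of_first_maximizer {ι α : Type*} [Fintype ι] [Nonempty ι] [LinearOrder ι]
    [LinearOrder α] {φ : ι → α} {k : ι} (hgt : ∀ j, k < j → φ j ≤ φ k)
    (hlt : ∀ j, j < k → φ j < φ k) : univ.sup' univ_nonempty φ = φ k := by
  refine le_antisymm (sup'_le _ _ fun j _ => ?_) (le_sup' φ (mem_univ k))
  rcases lt_trichotomy j k with h | rfl | h
  exacts [(hlt j h).le, le_rfl, hgt j h]

theorem forall_le_sub_iff_le_sub_sup' {ι : Type*} [Fintype ι] [Nonempty ι] (γ : ι → ℤ) (y c : ℤ) :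
    (∀ l, y ≤ c - γ l) ↔ y ≤ c - univ.sup' univ_nonempty γ := by
  rw [le_sub_comm, sup'_le_iff]
  simp [le_sub_comm]

/-- If extended profiles are the pairs `(s, y)` with `0 ≤ y ≤ u s`, then the nondominated ones
are exactly the graph of `u` over the nondominated profiles. -/
theorem pareto_hypograph {ι σ : Type*} {S : Set σ} {u : ι → σ → ℤ}
    (hpos : ∀ i, ∀ s ∈ S, 0 ≤ u i s) {T : Set (σ × (ι → ℤ))}
    (hT : ∀ p, p ∈ T ↔ p.1 ∈ S ∧ ∀ i, 0 ≤ p.2 i ∧ p.2 i ≤ u i p.1) :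
    (∀ p ∈ {p ∈ T | ¬∃ p' ∈ T, (∀ j, p.2 j ≤ p'.2 j) ∧ ∃ i, p.2 i < p'.2 i},
      ∀ i, p.2 i = u i p.1) ∧
    Set.BijOn (fun s => (s, fun i => u i s))
      {s ∈ S | ¬∃ s' ∈ S, (∀ j, u j s ≤ u j s') ∧ ∃ i, u i s < u i s'}
      {p ∈ T | ¬∃ p' ∈ T, (∀ j, p.2 j ≤ p'.2 j) ∧ ∃ i, p.2 i < p'.2 i} := by
  have graph_mem : ∀ s ∈ S, (s, fun i => u i s) ∈ T := fun s hs =>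
    (hT _).2 ⟨hs, fun i => ⟨hpos i s hs, le_rfl⟩⟩
  have eq_payoff : ∀ p ∈ {p ∈ T | ¬∃ p' ∈ T, (∀ j, p.2 j ≤ p'.2 j) ∧ ∃ i, p.2 i < p'.2 i},
      ∀ i, p.2 i = u i p.1 := by
    rintro p ⟨hp, hnd⟩ i
    obtain ⟨hs, hy⟩ := (hT p).1 hp
    by_contra hne
    exact hnd ⟨_, graph_mem _ hs, fun j => (hy j).2, i, (hy i).2.lt_of_ne hne⟩
  refine ⟨eq_payoff, ?_, fun s _ t _ h => congrArg Prod.fst h, ?_⟩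
  · rintro s ⟨hs, hnd⟩
    refine ⟨graph_mem s hs, ?_⟩
    rintro ⟨p, hp, hle, i, hlt⟩
    obtain ⟨hs', hy⟩ := (hT p).1 hp
    exact hnd ⟨p.1, hs', fun j => (hle j).trans (hy j).2, i, hlt.trans_le (hy i).2⟩
  · intro p hp
    have hgraph : (p.1, fun i => u i p.1) = p :=
      Prod.ext rfl (funext fun i => (eq_payoff p hp i).symm)
    refine ⟨p.1, ⟨((hT p).1 hp.1).1, ?_⟩, hgraph⟩
    rintro ⟨s', hs', hle, i, hlt⟩
    have heq := eq_payoff p hp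
    exact hp.2 ⟨_, graph_mem s' hs', fun j => (heq j).trans_le (hle j), i, (heq i).trans_lt hlt⟩

theorem stmt12
    {n : ℕ} {d : Fin n → ℕ}
    (Si : ∀ i, Set (Fin (d i) → ℤ))
    (hSfin : ∀ i, (Si i).Finite) (hSne : ∀ i, (Si i).Nonempty)
    {K L : Fin n → Type*}
    [∀ i, Fintype (K i)] [∀ i, Nonempty (K i)] [∀ i, LinearOrder (K i)]
    [∀ i, Fintype (L i)] [∀ i, Nonempty (L i)]
    (f : ∀ i, K i → (∀ j, Fin (d j) → ℤ) → ℤ)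
    (g : ∀ i, L i → (∀ j, Fin (d j) → ℤ) → ℤ)
    (hf : ∀ i k, ∃ (α : ∀ j, Fin (d j) → ℤ) (β : ℤ),
        ∀ s, f i k s = (∑ j, ∑ t, α j t * s j t) + β)
    (hg : ∀ i l, ∃ (γ : ∀ j, Fin (d j) → ℤ) (δ : ℤ),
        ∀ s, g i l s = (∑ j, ∑ t, γ j t * s j t) + δ)
    (S : Set (∀ j, Fin (d j) → ℤ)) (hS : S = Set.pi Set.univ Si)
    (u : ∀ i, (∀ j, Fin (d j) → ℤ) → ℤ)
    (hu : ∀ i s, u i s = (univ.sup' univ_nonempty fun k => f i k s)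
        - (univ.sup' univ_nonempty fun l => g i l s))
    (Sik : ∀ i, K i → Set (∀ j, Fin (d j) → ℤ))
    (hSik : ∀ i k, Sik i k = {s ∈ S |
        (∀ j, k < j → f i j s ≤ f i k s) ∧ (∀ j, j < k → f i j s < f i k s)})
    (Sk : (∀ i, K i) → Set (∀ j, Fin (d j) → ℤ))
    (hSk : ∀ k, Sk k = ⋂ i, Sik i (k i))
    (hpos : ∀ i, ∀ s ∈ S, 0 ≤ u i s)
    (Shatk : (∀ i, K i) → Set ((∀ j, Fin (d j) → ℤ) × (Fin n → ℤ)))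
    (hShatk : ∀ k, Shatk k = {p | p.1 ∈ Sk k ∧
        ∀ i, 0 ≤ p.2 i ∧ ∀ l : L i, p.2 i ≤ f i (k i) p.1 - g i l p.1})
    (Shat : Set ((∀ j, Fin (d j) → ℤ) × (Fin n → ℤ)))
    (hShat : Shat = ⋃ k, Shatk k)
    (POhat : Set ((∀ j, Fin (d j) → ℤ) × (Fin n → ℤ)))
    (hPOhat : POhat = {p ∈ Shat | ¬∃ p' ∈ Shat,
        (∀ j, p.2 j ≤ p'.2 j) ∧ ∃ i, p.2 i < p'.2 i})
    (PO : Set (∀ j, Fin (d j) → ℤ))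
    (hPO : PO = {s ∈ S | ¬∃ s' ∈ S,
        (∀ j, u j s ≤ u j s') ∧ ∃ i, u i s < u i s'})
    :
    (∀ p ∈ POhat, ∀ i, p.2 i = u i p.1) ∧
    Set.BijOn (fun s => (s, fun i => u i s)) PO POhat := by
  have hT : ∀ p, p ∈ Shat ↔ p.1 ∈ S ∧ ∀ i, 0 ≤ p.2 i ∧ p.2 i ≤ u i p.1 := by
    have hne : ∀ s ∈ S, ∃ k, s ∈ Sk k := by
      intro s hs
      choose k hk using fun i => exists_first_maximizer fun j => f i j s
      exact ⟨k, by simpa [hSk, hSik, hs] using hk⟩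
    have hu' : ∀ k, ∀ s ∈ Sk k, ∀ i y, (∀ l, y ≤ f i (k i) s - g i l s) ↔ y ≤ u i s := by
      intro k s hs i y
      rw [hSk, Set.mem_iInter] at hs
      have hsi := hs i
      rw [hSik] at hsi
      rw [hu, sup'_univ_eq_of_first_maximizer hsi.2.1 hsi.2.2,
        forall_le_sub_iff_le_sub_sup' fun l => g i l s]
    have mem_Shat : ∀ p, p ∈ Shat ↔
        ∃ k, p.1 ∈ Sk k ∧ ∀ i, 0 ≤ p.2 i ∧ ∀ l, p.2 i ≤ f i (k i) p.1 - g i l p.1 := by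
      simp [hShat, hShatk]
    intro p
    rw [mem_Shat]
    constructor
    · rintro ⟨k, hs, hy⟩
      refine ⟨?_, fun i => ⟨(hy i).1, (hu' k _ hs i _).1 (hy i).2⟩⟩
      rw [hSk, Set.mem_iInter] at hs
      rw [hS, Set.mem_univ_pi]
      intro i
      have hsi := hs i
      rw [hSik, hS] at hsi
      exact hsi.1 i (Set.mem_univ i)
    · rintro ⟨hs, hy⟩
      obtain ⟨k, hk⟩ := hne _ hs
      exact ⟨k, hk, fun i => ⟨(hy i).1, (hu' k _ hk i _).2 (hy i).2⟩⟩
  rw [hPOhat, hPO]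
  exact pareto_hypograph hpos hT
end

section
/- The maximum social welfare of the game equals the maximum of the sum of the extended payoff variables over the extended action profiles: max{ Σ_{i=1}^n u_i(s) : s ∈ S } = max{ Σ_{i=1}^n y_i : (s, y) ∈ Ŝ } (both maxima exist since S is finite and nonempty and Ŝ is finite and nonempty). -/
open Finset

theorem exists_first_argmax {κ : Type*} [Fintype κ] [Nonempty κ] [LinearOrder κ] (φ : κ → ℤ) :
    ∃ k, (∀ j, φ j ≤ φ k) ∧ ∀ j, j < k → φ j < φ k := by
  obtain ⟨m, hm⟩ := Finite.exists_max φ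
  have hne : (univ.filter fun k => ∀ j, φ j ≤ φ k).Nonempty := ⟨m, by simpa using hm⟩
  have hmax : ∀ j, φ j ≤ φ (Finset.min' _ hne) := by
    simpa using Finset.min'_mem _ hne
  refine ⟨Finset.min' _ hne, hmax, fun j hj => lt_of_not_ge fun h => ?_⟩
  exact absurd (Finset.min'_le _ j (by simpa using fun a => (hmax a).trans h)) (not_le.mpr hj)

theorem stmt13
    {n : ℕ} {d : Fin n → ℕ}
    (Si : ∀ i, Set (Fin (d i) → ℤ))
    (hSfin : ∀ i, (Si i).Finite) (hSne : ∀ i, (Si i).Nonempty)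
    {K L : Fin n → Type*}
    [∀ i, Fintype (K i)] [∀ i, Nonempty (K i)] [∀ i, LinearOrder (K i)]
    [∀ i, Fintype (L i)] [∀ i, Nonempty (L i)]
    (f : ∀ i, K i → (∀ j, Fin (d j) → ℤ) → ℤ)
    (g : ∀ i, L i → (∀ j, Fin (d j) → ℤ) → ℤ)
    (hf : ∀ i k, ∃ (α : ∀ j, Fin (d j) → ℤ) (β : ℤ),
        ∀ s, f i k s = (∑ j, ∑ t, α j t * s j t) + β)
    (hg : ∀ i l, ∃ (γ : ∀ j, Fin (d j) → ℤ) (δ : ℤ),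
        ∀ s, g i l s = (∑ j, ∑ t, γ j t * s j t) + δ)
    (S : Set (∀ j, Fin (d j) → ℤ)) (hS : S = Set.pi Set.univ Si)
    (u : ∀ i, (∀ j, Fin (d j) → ℤ) → ℤ)
    (hu : ∀ i s, u i s = (univ.sup' univ_nonempty fun k => f i k s)
        - (univ.sup' univ_nonempty fun l => g i l s))
    (Sik : ∀ i, K i → Set (∀ j, Fin (d j) → ℤ))
    (hSik : ∀ i k, Sik i k = {s ∈ S |
        (∀ j, k < j → f i j s ≤ f i k s) ∧ (∀ j, j < k → f i j s < f i k s)})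
    (Sk : (∀ i, K i) → Set (∀ j, Fin (d j) → ℤ))
    (hSk : ∀ k, Sk k = ⋂ i, Sik i (k i))
    (hpos : ∀ i, ∀ s ∈ S, 0 ≤ u i s)
    (Shatk : (∀ i, K i) → Set ((∀ j, Fin (d j) → ℤ) × (Fin n → ℤ)))
    (hShatk : ∀ k, Shatk k = {p | p.1 ∈ Sk k ∧
        ∀ i, 0 ≤ p.2 i ∧ ∀ l : L i, p.2 i ≤ f i (k i) p.1 - g i l p.1})
    (Shat : Set ((∀ j, Fin (d j) → ℤ) × (Fin n → ℤ)))
    (hShat : Shat = ⋃ k, Shatk k)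
    :
    ∃ w : ℤ, IsGreatest ((fun s => ∑ i, u i s) '' S) w ∧
      IsGreatest ((fun p : (∀ j, Fin (d j) → ℤ) × (Fin n → ℤ) => ∑ i, p.2 i) '' Shat) w := by
  have hSmem : ∀ s ∈ S, ∃ k, s ∈ Sk k ∧
      ∀ i, (univ.sup' univ_nonempty fun k => f i k s) = f i (k i) s := by
    intro s hs
    choose k hmax hlt using fun i => exists_first_argmax fun k => f i k s
    refine ⟨k, ?_, fun i => le_antisymm (Finset.sup'_le _ _ fun j _ => hmax i j)
      (Finset.le_sup' (fun k => f i k s) (mem_univ (k i)))⟩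
    rw [hSk, Set.mem_iInter]
    intro i
    rw [hSik]
    exact ⟨hs, fun j _ => hmax i j, hlt i⟩
  have hSkS : ∀ k, Sk k ⊆ S := by
    intro k s hs
    rw [hSk, Set.mem_iInter] at hs
    have key : ∀ i, s ∈ S := fun i => by
      have h := hs i
      rw [hSik] at h
      exact h.1
    rw [hS] at key ⊢
    exact fun i _ => key i i (Set.mem_univ i)
  have hfin : S.Finite := hS ▸ Set.Finite.pi hSfin
  have hne : S.Nonempty := hS ▸ Set.univ_pi_nonempty_iff.mpr hSne
  obtain ⟨s, hs, hmax⟩ := hfin.exists_maximalFor (fun s => ∑ i, u i s) S hne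
  have hle : ∀ t ∈ S, ∑ i, u i t ≤ ∑ i, u i s := fun t ht =>
    (le_total (∑ i, u i t) (∑ i, u i s)).elim id fun h => hmax ht h
  refine ⟨∑ i, u i s, ⟨⟨s, hs, rfl⟩, ?_⟩, ⟨(s, fun i => u i s), ?_, rfl⟩, ?_⟩
  · rintro _ ⟨t, ht, rfl⟩
    exact hle t ht
  · obtain ⟨k, hk, hfk⟩ := hSmem s hs
    rw [hShat, Set.mem_iUnion]
    refine ⟨k, ?_⟩
    rw [hShatk]
    refine ⟨hk, fun i => ⟨hpos i s hs, fun l => ?_⟩⟩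
    have h := Finset.le_sup' (fun l => g i l s) (mem_univ l)
    have h' := hu i s
    rw [hfk i] at h'
    dsimp only at h ⊢
    linarith
  · rintro _ ⟨⟨t, y⟩, hp, rfl⟩
    rw [hShat, Set.mem_iUnion] at hp
    obtain ⟨k, hp⟩ := hp
    rw [hShatk] at hp
    obtain ⟨ht, hy⟩ := hp
    refine le_trans (Finset.sum_le_sum fun i _ => ?_) (hle t (hSkS k ht))
    obtain ⟨l, -, hl⟩ := Finset.exists_mem_eq_sup' univ_nonempty fun l => g i l t
    have h := Finset.le_sup' (fun k => f i k t) (mem_univ (k i))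
    have h' := (hy i).2 l
    dsimp only at h h' ⊢
    rw [hu, hl]
    linarith
end
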